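/- arXiv:1301.2909 — 2 statements merged into one kernel-verified Lean document; each statement's English description precedes it below -/
import Mathlib

section
/- Let n ≥ 2 and let f : ℝⁿ → ℝ be locally Lipschitz. Write points of ℝⁿ as (t, x') with t ∈ ℝ and x' ∈ ℝ^{n−1}. Then for Lebesgue-almost every x' ∈ ℝ^{n−1}, the set of t ∈ ℝ at which f fails to be (Fréchet) differentiable at (t, x') has one-dimensional Lebesgue measure zero; moreover, at almost every such t the function t ↦ f(t, x') is differentiable with derivative equal to the first partial derivative ∂₁f(t, x') (the Fréchet derivative of f at (t,x') applied to the first standard basis vector e₁). -/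
open MeasureTheory

/-- *Rademacher's theorem* for locally Lipschitz functions. -/
theorem LocallyLipschitz.ae_differentiableAt {E F : Type*}
    [NormedAddCommGroup E] [NormedSpace ℝ E] [FiniteDimensional ℝ E]
    [MeasurableSpace E] [BorelSpace E]
    [NormedAddCommGroup F] [NormedSpace ℝ F] [FiniteDimensional ℝ F]
    {μ : Measure E} [μ.IsAddHaarMeasure] {f : E → F} (hf : LocallyLipschitz f) :
    ∀ᵐ x ∂μ, DifferentiableAt ℝ f x := by
  have : ProperSpace E := FiniteDimensional.proper ℝ E
  refine measure_null_of_locally_null _ fun x _ => ?_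
  obtain ⟨K, s, hs, hKs⟩ := hf x
  have h := (hKs.mono interior_subset).ae_differentiableWithinAt_of_mem (μ := μ)
  refine ⟨{x | DifferentiableAt ℝ f x}ᶜ ∩ interior s,
    Filter.inter_mem self_mem_nhdsWithin
      (mem_nhdsWithin_of_mem_nhds (interior_mem_nhds.2 hs)), ?_⟩
  refine measure_mono_null ?_ (ae_iff.1 h)
  rintro y ⟨hy, hys⟩ hyd
  exact hy ((hyd hys).differentiableAt (isOpen_interior.mem_nhds hys))

/-- Fubini-type consequence of Rademacher's theorem: for a locally Lipschitz
function `f` on `ℝⁿ = ℝ × ℝ^{n-1}` (with `n ≥ 2`), for a.e. `x'` the function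
is Fréchet differentiable at `(t, x')` for a.e. `t`, and the restriction
`t ↦ f (t, x')` is differentiable there with derivative `∂₁ f (t, x')`,
the Fréchet derivative applied to the first basis vector `e₁ = (1, 0)`. -/
theorem stmt_1 (m : ℕ) (hm : 1 ≤ m)
    (f : ℝ × EuclideanSpace ℝ (Fin m) → ℝ) (hf : LocallyLipschitz f) :
    ∀ᵐ x' ∂(volume : Measure (EuclideanSpace ℝ (Fin m))),
      ∀ᵐ t ∂(volume : Measure ℝ),
        DifferentiableAt ℝ f (t, x') ∧
        HasDerivAt (fun s : ℝ => f (s, x')) (fderiv ℝ f (t, x') (1, 0)) t := by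
  have h : ∀ᵐ p ∂((volume : Measure ℝ).prod (volume : Measure (EuclideanSpace ℝ (Fin m)))),
      DifferentiableAt ℝ f p := hf.ae_differentiableAt
  have h_swap := Measure.ae_ae_of_ae_prod (Measure.measurePreserving_swap.quasiMeasurePreserving.ae h)
  filter_upwards [h_swap] with x' hx'
  filter_upwards [hx'] with t ht
  exact ⟨ht, ht.hasFDerivAt.comp_hasDerivAt t ((hasDerivAt_id t).prodMk (hasDerivAt_const t x'))⟩
end

section
/- Let n ≥ 1, let f : ℝⁿ → ℝ be locally Lipschitz, let C > 0, and let v ∈ ℝⁿ be a unit vector. Suppose that for Lebesgue-almost every x ∈ ℝⁿ, f is Fréchet differentiable at x and df_x(v) ≥ C. Then for every x ∈ ℝⁿ and every t ≥ 0 one has f(x + t·v) − f(x) ≥ C·t. -/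
open MeasureTheory

/-- A locally Lipschitz function on the line whose derivative is almost everywhere at least `C`
grows at least at rate `C`. -/
theorem LocallyLipschitz.mul_sub_le_sub_of_ae_le_deriv {g : ℝ → ℝ} (hg : LocallyLipschitz g)
    {C : ℝ} (hC : ∀ᵐ s, C ≤ deriv g s) {a b : ℝ} (hab : a ≤ b) :
    C * (b - a) ≤ g b - g a := by
  obtain ⟨K, hK⟩ := LocallyLipschitzOn.exists_lipschitzOnWith_of_compact
    (isCompact_uIcc (a := a) (b := b)) hg.locallyLipschitzOn
  have hac := hK.absolutelyContinuousOnInterval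
  calc C * (b - a) = ∫ _ in a..b, C := by simp [mul_comm]
    _ ≤ ∫ s in a..b, deriv g s :=
      intervalIntegral.integral_mono_ae hab intervalIntegrable_const
        hac.intervalIntegrable_deriv hC
    _ = g b - g a := hac.integral_deriv_eq_sub

/-- A property which holds almost everywhere holds, on almost every line in a given direction,
almost everywhere on that line. -/
theorem ae_ae_add_smul_of_ae {E : Type*} [NormedAddCommGroup E] [NormedSpace ℝ E]
    [FiniteDimensional ℝ E] [MeasurableSpace E] [BorelSpace E] {μ : Measure E}
    [μ.IsAddHaarMeasure] {p : E → Prop} (hp : ∀ᵐ x ∂μ, p x) (v : E) :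
    ∀ᵐ x ∂μ, ∀ᵐ s : ℝ, p (x + s • v) := by
  have : ProperSpace E := FiniteDimensional.proper ℝ E
  obtain ⟨S, hS, hSm, hSp⟩ := hp.exists_measurable_mem
  filter_upwards [(ae_ae_add_linearMap_mem_iff (LinearMap.toSpanSingleton ℝ E v)
    volume μ hSm).2 hS] with x hx
  filter_upwards [hx] with s hs
  exact hSp _ hs

/-- Anti-Lipschitz propagation along straight lines (Theorem `xhx`): if a
locally Lipschitz `f : ℝⁿ → ℝ` satisfies `df_x(v) ≥ C` at Lebesgue-almost
every point `x`, for a fixed unit vector `v`, then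
`f (x + t v) - f x ≥ C t` for every `x` and every `t ≥ 0`. -/
theorem stmt_7 (n : ℕ) (hn : 1 ≤ n)
    (f : EuclideanSpace ℝ (Fin n) → ℝ) (hf : LocallyLipschitz f)
    (C : ℝ) (hC : 0 < C) (v : EuclideanSpace ℝ (Fin n)) (hv : ‖v‖ = 1)
    (h : ∀ᵐ x ∂(volume : Measure (EuclideanSpace ℝ (Fin n))),
      DifferentiableAt ℝ f x ∧ C ≤ fderiv ℝ f x v) :
    ∀ x : EuclideanSpace ℝ (Fin n), ∀ t : ℝ, 0 ≤ t →
      C * t ≤ f (x + t • v) - f x := by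
  intro x t ht
  have hdense : Dense {x | ∀ᵐ s : ℝ, DifferentiableAt ℝ f (x + s • v) ∧
      C ≤ fderiv ℝ f (x + s • v) v} :=
    Measure.dense_of_ae (ae_ae_add_smul_of_ae h v)
  have hclosed : IsClosed {x | C * t ≤ f (x + t • v) - f x} := by
    have hfc := hf.continuous
    exact isClosed_le (by fun_prop) (by fun_prop)
  refine closure_minimal (fun y hy => ?_) hclosed (hdense x)
  have hline : LocallyLipschitz fun s : ℝ => y + s • v :=
    ContDiff.locallyLipschitz (𝕂 := ℝ) (by fun_prop)
  have hderiv : ∀ᵐ s : ℝ, C ≤ deriv (fun s : ℝ => f (y + s • v)) s := by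
    filter_upwards [hy] with s hs
    have hv' : HasDerivAt (fun s : ℝ => y + s • v) v s := by
      simpa using ((hasDerivAt_id s).smul_const v).const_add y
    exact (hs.1.hasFDerivAt.comp_hasDerivAt s hv').deriv.symm ▸ hs.2
  simpa using (hf.comp hline).mul_sub_le_sub_of_ae_le_deriv hderiv ht
end
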